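/- Fix an integer n ≥ 1. There exist constants P ≥ 1 and C ≥ 1 depending only on n such that for every box B = ∏_{i=1}^n (−a_i, a_i) ⊆ ℝⁿ, every point x in the closure of B, every r > 0, and every smooth function f on B with ∫_{B ∩ B(x,Cr)} |∇f|² φ_B² dy < ∞, one has ∫_{E} |f(y) − f_E|² φ_B(y)² dy ≤ P·r²·∫_{B ∩ B(x,Cr)} |∇f(y)|² φ_B(y)² dy, where E := B ∩ B(x,r), f_E := (∫_E f φ_B² dy)/(∫_E φ_B² dy) is the weighted average of f over E, B(x,r) denotes the Euclidean ball of center x and radius r, and φ_B(y) = ∏_{i=1}^n a_i^{−1/2} cos(π y_i/(2 a_i)). -/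

import Mathlib

open Real MeasureTheory

/-- The open box `∏ i (-a i, a i)` in `ℝⁿ`. -/
def box (n : ℕ) (a : Fin n → ℝ) : Set (EuclideanSpace ℝ (Fin n)) := {x | ∀ i, |x i| < a i}

/-- The principal Dirichlet eigenfunction of the box `∏ i (-a i, a i)`. -/
noncomputable def boxEigenfunction (n : ℕ) (a : Fin n → ℝ)
    (x : EuclideanSpace ℝ (Fin n)) : ℝ :=
  ∏ i, (1 / Real.sqrt (a i)) * Real.cos (π * x i / (2 * a i))

open scoped ENNReal

section SegmentIntegrals

variable {V : Type*} [NormedAddCommGroup V] [NormedSpace ℝ V]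

lemma sq_intervalIntegral_le {h : ℝ → ℝ} (hh : ContinuousOn h (Set.Icc 0 1)) :
    (∫ t in (0 : ℝ)..1, h t) ^ 2 ≤ ∫ t in (0 : ℝ)..1, h t ^ 2 := by
  have h1 : IntervalIntegrable h volume 0 1 :=
    ContinuousOn.intervalIntegrable (by rwa [Set.uIcc_of_le zero_le_one])
  have h2 : IntervalIntegrable (fun t => h t ^ 2) volume 0 1 :=
    ContinuousOn.intervalIntegrable (by rw [Set.uIcc_of_le zero_le_one]; exact hh.pow 2)
  set c := ∫ t in (0 : ℝ)..1, h t with hc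
  have hpos : 0 ≤ ∫ t in (0 : ℝ)..1, (h t - c) ^ 2 :=
    intervalIntegral.integral_nonneg zero_le_one fun t _ => sq_nonneg _
  have hexp : ∫ t in (0 : ℝ)..1, (h t - c) ^ 2
      = (∫ t in (0 : ℝ)..1, h t ^ 2) - 2 * c * c + c ^ 2 := by
    have : (fun t => (h t - c) ^ 2) = fun t => (h t ^ 2 - 2 * c * h t) + c ^ 2 := by
      funext t; ring
    rw [this, intervalIntegral.integral_add (h2.sub (h1.const_mul _)) (by simp),
      intervalIntegral.integral_sub h2 (h1.const_mul _),
      intervalIntegral.integral_const_mul, ← hc]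
    simp
  nlinarith

/-- The squared increment of a `C¹` function along a segment is controlled by the integral of its
squared derivative along this segment. -/
lemma ofReal_sq_sub_le_lintegral_lineMap {s : Set V} (hs : IsOpen s) {f : V → ℝ}
    (hf : ContDiffOn ℝ 1 f s) {y z : V} (hyz : ∀ t ∈ Set.Icc (0 : ℝ) 1,
      AffineMap.lineMap y z t ∈ s) :
    ENNReal.ofReal ((f y - f z) ^ 2) ≤ ENNReal.ofReal (dist y z ^ 2) *
      ∫⁻ t in Set.Icc (0 : ℝ) 1, ENNReal.ofReal (‖fderiv ℝ f (AffineMap.lineMap y z t)‖ ^ 2) := by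
  have hline : Continuous fun t : ℝ => (AffineMap.lineMap y z t : V) := AffineMap.lineMap_continuous
  have hD : ContinuousOn (fun t : ℝ => fderiv ℝ f (AffineMap.lineMap y z t)) (Set.Icc 0 1) :=
    (hf.continuousOn_fderiv_of_isOpen hs le_rfl).comp hline.continuousOn hyz
  have hh : ContinuousOn (fun t : ℝ => fderiv ℝ f (AffineMap.lineMap y z t) (z - y))
      (Set.Icc 0 1) := hD.clm_apply continuousOn_const
  have hderiv : ∀ t ∈ Set.uIcc (0 : ℝ) 1, HasDerivAt (fun t : ℝ => f (AffineMap.lineMap y z t))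
      (fderiv ℝ f (AffineMap.lineMap y z t) (z - y)) t := by
    intro t ht
    rw [Set.uIcc_of_le zero_le_one] at ht
    have hd : DifferentiableAt ℝ f (AffineMap.lineMap y z t) :=
      (hf.differentiableOn one_ne_zero).differentiableAt (hs.mem_nhds (hyz t ht))
    exact hd.hasFDerivAt.comp_hasDerivAt t AffineMap.hasDerivAt_lineMap
  have hftc := intervalIntegral.integral_eq_sub_of_hasDerivAt hderiv
    (ContinuousOn.intervalIntegrable (by rwa [Set.uIcc_of_le zero_le_one]))
  simp only [AffineMap.lineMap_apply_one, AffineMap.lineMap_apply_zero] at hftc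
  have hn : ContinuousOn (fun t : ℝ => ‖fderiv ℝ f (AffineMap.lineMap y z t)‖ ^ 2)
      (Set.Icc 0 1) := hD.norm.pow 2
  have hmain : (f y - f z) ^ 2 ≤ dist y z ^ 2 *
      ∫ t in Set.Icc (0 : ℝ) 1, ‖fderiv ℝ f (AffineMap.lineMap y z t)‖ ^ 2 := by
    calc (f y - f z) ^ 2 = (f z - f y) ^ 2 := by ring
      _ ≤ ∫ t in (0 : ℝ)..1, (fderiv ℝ f (AffineMap.lineMap y z t) (z - y)) ^ 2 := by
          rw [← hftc]; exact sq_intervalIntegral_le hh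
      _ ≤ ∫ t in (0 : ℝ)..1, dist y z ^ 2 * ‖fderiv ℝ f (AffineMap.lineMap y z t)‖ ^ 2 := by
          refine intervalIntegral.integral_mono_on zero_le_one
            (ContinuousOn.intervalIntegrable ?_) (ContinuousOn.intervalIntegrable ?_) ?_
          · rw [Set.uIcc_of_le zero_le_one]; exact hh.pow 2
          · rw [Set.uIcc_of_le zero_le_one]; exact continuousOn_const.mul hn
          · intro t _
            rw [← mul_pow, ← sq_abs, dist_comm, dist_eq_norm, mul_comm, ← Real.norm_eq_abs]
            gcongr
            exact ContinuousLinearMap.le_opNorm _ _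
      _ = _ := by
          rw [intervalIntegral.integral_const_mul, intervalIntegral.integral_of_le zero_le_one,
            integral_Icc_eq_integral_Ioc]
  calc ENNReal.ofReal ((f y - f z) ^ 2) ≤ _ := ENNReal.ofReal_le_ofReal hmain
    _ = _ := by
      rw [ENNReal.ofReal_mul (by positivity), ofReal_integral_eq_lintegral_ofReal
        (hn.integrableOn_compact isCompact_Icc) (Filter.Eventually.of_forall fun t => by positivity)]

variable [FiniteDimensional ℝ V] [MeasurableSpace V] [BorelSpace V]
  (μ : Measure V) [μ.IsAddHaarMeasure]

lemma lintegral_comp_add_smul {H : V → ℝ≥0∞} (hH : Measurable H) (b : V) {c : ℝ} (hc : c ≠ 0) :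
    ∫⁻ y, H (b + c • y) ∂μ =
      ENNReal.ofReal |(c ^ Module.finrank ℝ V)⁻¹| * ∫⁻ y, H y ∂μ := by
  rw [← lintegral_add_left_eq_self H b, ← smul_eq_mul, ← lintegral_smul_measure,
    ← Measure.map_addHaar_smul μ hc, lintegral_map (by fun_prop) (by fun_prop)]

variable {s : Set V} {W G : V → ℝ≥0∞} {K : ℝ≥0∞}

lemma lintegral_lineMap_mul_le_of_le_half (hs : IsOpen s) (hconv : Convex ℝ s)
    (hW : Measurable W) (hG : Measurable G)
    (hK : ∀ y ∈ s, ∀ z ∈ s, ∀ t ∈ Set.Icc (0 : ℝ) (1 / 2),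
      W y ≤ K * W (AffineMap.lineMap y z t))
    {t : ℝ} (ht : t ∈ Set.Icc (0 : ℝ) (1 / 2)) :
    ∫⁻ z in s, ∫⁻ y in s, G (AffineMap.lineMap y z t) * (W y * W z) ∂μ ∂μ ≤
      K * 2 ^ Module.finrank ℝ V * (∫⁻ z in s, W z ∂μ) * ∫⁻ y in s, G y * W y ∂μ := by
  have hH : Measurable (s.indicator fun y => G y * W y) :=
    (hG.mul hW).indicator hs.measurableSet
  have hpos : 0 < 1 - t := by linarith [ht.2]
  have hscale : ENNReal.ofReal |((1 - t) ^ Module.finrank ℝ V)⁻¹| ≤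
      2 ^ Module.finrank ℝ V := by
    rw [abs_of_pos (by positivity), ← inv_pow, ENNReal.ofReal_pow (by positivity)]
    gcongr
    rw [← ENNReal.ofReal_ofNat]
    apply ENNReal.ofReal_le_ofReal
    rw [inv_le_comm₀ hpos two_pos]
    linarith [ht.2]
  have hinner : ∀ z ∈ s, ∫⁻ y in s, G (AffineMap.lineMap y z t) * (W y * W z) ∂μ ≤
      (K * 2 ^ Module.finrank ℝ V * ∫⁻ y in s, G y * W y ∂μ) * W z := by
    intro z hz
    calc ∫⁻ y in s, G (AffineMap.lineMap y z t) * (W y * W z) ∂μ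
        ≤ ∫⁻ y in s, (K * W z) * s.indicator (fun y => G y * W y) (t • z + (1 - t) • y) ∂μ := by
          refine setLIntegral_mono' hs.measurableSet fun y hy => ?_
          have hmem : AffineMap.lineMap y z t ∈ s :=
            hconv.lineMap_mem hy hz ⟨ht.1, by linarith [ht.2]⟩
          have heq : t • z + (1 - t) • y = AffineMap.lineMap y z t := by
            rw [AffineMap.lineMap_apply_module, add_comm]
          rw [heq, Set.indicator_of_mem hmem]
          calc _ ≤ G (AffineMap.lineMap y z t) * ((K * W (AffineMap.lineMap y z t)) * W z) := by
                gcongr; exact hK y hy z hz t ht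
            _ = _ := by ring
      _ ≤ ∫⁻ y, (K * W z) * s.indicator (fun y => G y * W y) (t • z + (1 - t) • y) ∂μ :=
          setLIntegral_le_lintegral _ _
      _ ≤ _ := by
          rw [lintegral_const_mul _ (by fun_prop), lintegral_comp_add_smul μ hH _ hpos.ne',
            lintegral_indicator hs.measurableSet]
          calc _ ≤ K * W z * (2 ^ Module.finrank ℝ V * ∫⁻ y in s, G y * W y ∂μ) := by gcongr
            _ = _ := by ring
  calc _ ≤ ∫⁻ z in s, (K * 2 ^ Module.finrank ℝ V * ∫⁻ y in s, G y * W y ∂μ) * W z ∂μ :=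
        setLIntegral_mono' hs.measurableSet hinner
    _ = _ := by rw [lintegral_const_mul _ hW]; ring

lemma lintegral_lineMap_mul_le (hs : IsOpen s) (hconv : Convex ℝ s)
    (hW : Measurable W) (hG : Measurable G)
    (hK : ∀ y ∈ s, ∀ z ∈ s, ∀ t ∈ Set.Icc (0 : ℝ) (1 / 2),
      W y ≤ K * W (AffineMap.lineMap y z t))
    {t : ℝ} (ht : t ∈ Set.Icc (0 : ℝ) 1) :
    ∫⁻ z in s, ∫⁻ y in s, G (AffineMap.lineMap y z t) * (W y * W z) ∂μ ∂μ ≤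
      K * 2 ^ Module.finrank ℝ V * (∫⁻ z in s, W z ∂μ) * ∫⁻ y in s, G y * W y ∂μ := by
  rcases le_total t (1 / 2) with h | h
  · exact lintegral_lineMap_mul_le_of_le_half μ hs hconv hW hG hK ⟨ht.1, h⟩
  · have hmeas : Measurable fun p : V × V =>
        G (AffineMap.lineMap p.2 p.1 t) * (W p.2 * W p.1) := by
      simp only [AffineMap.lineMap_apply_module]
      fun_prop
    rw [lintegral_lintegral_swap hmeas.aemeasurable]
    refine le_trans (le_of_eq ?_) (lintegral_lineMap_mul_le_of_le_half μ hs hconv hW hG hK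
      (t := 1 - t) ⟨by linarith [ht.2], by linarith⟩)
    refine lintegral_congr fun z => lintegral_congr fun y => ?_
    rw [AffineMap.lineMap_apply_one_sub, mul_comm (W z)]

lemma lintegral_lintegral_lintegral_lineMap_swap (hW : Measurable W) (hG : Measurable G) :
    ∫⁻ z in s, ∫⁻ y in s, (∫⁻ t in Set.Icc (0 : ℝ) 1,
        G (AffineMap.lineMap y z t) * (W y * W z)) ∂μ ∂μ =
      ∫⁻ t in Set.Icc (0 : ℝ) 1, ∫⁻ z in s, ∫⁻ y in s,
        G (AffineMap.lineMap y z t) * (W y * W z) ∂μ ∂μ := by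
  simp only [AffineMap.lineMap_apply_module]
  have hinner : ∀ z, ∫⁻ y in s, (∫⁻ t in Set.Icc (0 : ℝ) 1,
      G ((1 - t) • y + t • z) * (W y * W z)) ∂μ = ∫⁻ t in Set.Icc (0 : ℝ) 1, ∫⁻ y in s,
      G ((1 - t) • y + t • z) * (W y * W z) ∂μ := by
    intro z
    have hmeas : Measurable fun p : V × ℝ =>
        G ((1 - p.2) • p.1 + p.2 • z) * (W p.1 * W z) := by fun_prop
    exact lintegral_lintegral_swap hmeas.aemeasurable
  simp_rw [hinner]
  have hmeas : Measurable fun p : (V × ℝ) × V =>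
      G ((1 - p.1.2) • p.2 + p.1.2 • p.1.1) * (W p.2 * W p.1.1) := by fun_prop
  exact lintegral_lintegral_swap (hmeas.lintegral_prod_right' (ν := μ.restrict s)).aemeasurable

/-- A double-integral form of the weighted Poincaré inequality on a convex open set, for weights
which do not decrease by more than a constant factor over the first half of any segment. -/
lemma lintegral_sq_sub_mul_le (hs : IsOpen s) (hconv : Convex ℝ s) {f : V → ℝ}
    (hf : ContDiffOn ℝ 1 f s) (hW : Measurable W)
    (hK : ∀ y ∈ s, ∀ z ∈ s, ∀ t ∈ Set.Icc (0 : ℝ) (1 / 2),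
      W y ≤ K * W (AffineMap.lineMap y z t))
    {D : ℝ} (hD : ∀ y ∈ s, ∀ z ∈ s, dist y z ≤ D) :
    ∫⁻ z in s, ∫⁻ y in s, ENNReal.ofReal ((f y - f z) ^ 2) * (W y * W z) ∂μ ∂μ ≤
      ENNReal.ofReal (D ^ 2) * (K * 2 ^ Module.finrank ℝ V * (∫⁻ z in s, W z ∂μ) *
        ∫⁻ y in s, ENNReal.ofReal (‖fderiv ℝ f y‖ ^ 2) * W y ∂μ) := by
  set G : V → ℝ≥0∞ := fun y => ENNReal.ofReal (‖fderiv ℝ f y‖ ^ 2)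
  have hG : Measurable G := ((measurable_fderiv ℝ f).norm.pow_const 2).ennreal_ofReal
  have hpt : ∀ z ∈ s, ∀ y ∈ s, ENNReal.ofReal ((f y - f z) ^ 2) * (W y * W z) ≤
      ENNReal.ofReal (D ^ 2) * ∫⁻ t in Set.Icc (0 : ℝ) 1,
        G (AffineMap.lineMap y z t) * (W y * W z) := by
    intro z hz y hy
    have hGline : Measurable fun t : ℝ => G (AffineMap.lineMap y z t) :=
      hG.comp AffineMap.lineMap_continuous.measurable
    rw [lintegral_mul_const _ hGline, ← mul_assoc (ENNReal.ofReal (D ^ 2))]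
    gcongr ?_ * (W y * W z)
    refine (ofReal_sq_sub_le_lintegral_lineMap hs hf
      fun t ht => hconv.lineMap_mem hy hz ht).trans ?_
    gcongr
    exact hD y hy z hz
  calc _ ≤ ∫⁻ z in s, ∫⁻ y in s, ENNReal.ofReal (D ^ 2) * (∫⁻ t in Set.Icc (0 : ℝ) 1,
        G (AffineMap.lineMap y z t) * (W y * W z)) ∂μ ∂μ :=
      setLIntegral_mono' hs.measurableSet fun z hz =>
        setLIntegral_mono' hs.measurableSet fun y hy => hpt z hz y hy
    _ = ENNReal.ofReal (D ^ 2) * ∫⁻ t in Set.Icc (0 : ℝ) 1, ∫⁻ z in s, ∫⁻ y in s,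
        G (AffineMap.lineMap y z t) * (W y * W z) ∂μ ∂μ := by
      simp_rw [lintegral_const_mul' _ _ ENNReal.ofReal_ne_top]
      rw [lintegral_lintegral_lintegral_lineMap_swap μ hW hG]
    _ ≤ ENNReal.ofReal (D ^ 2) * ∫⁻ _t in Set.Icc (0 : ℝ) 1,
        (K * 2 ^ Module.finrank ℝ V * (∫⁻ z in s, W z ∂μ) * ∫⁻ y in s, G y * W y ∂μ) := by
      exact mul_le_mul' le_rfl (setLIntegral_mono' measurableSet_Icc fun t ht =>
        lintegral_lineMap_mul_le μ hs hconv hW hG hK ht)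
    _ = _ := by rw [setLIntegral_const, Real.volume_Icc, sub_zero, ENNReal.ofReal_one, mul_one]

end SegmentIntegrals

section Variance

variable {α : Type*} [MeasurableSpace α] {ν : Measure α} {f w : α → ℝ}

/-- The weighted average minimises the weighted mean square deviation. -/
lemma integral_sq_sub_average_mul_le (hf : AEStronglyMeasurable f ν) (hw : Integrable w ν)
    (hw0 : 0 ≤ᵐ[ν] w) (hW : ∫ x, w x ∂ν ≠ 0)
    (hint : Integrable (fun x => (f x - (∫ z, f z * w z ∂ν) / ∫ z, w z ∂ν) ^ 2 * w x) ν) (d : ℝ) :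
    ENNReal.ofReal (∫ x, (f x - (∫ z, f z * w z ∂ν) / ∫ z, w z ∂ν) ^ 2 * w x ∂ν) ≤
      ∫⁻ x, ENNReal.ofReal ((f x - d) ^ 2 * w x) ∂ν := by
  set c := (∫ z, f z * w z ∂ν) / ∫ z, w z ∂ν with hc
  have h1 : Integrable (fun x => (f x - c) * w x) ν := by
    refine (hint.add hw).mono' ((hf.sub aestronglyMeasurable_const).mul hw.1) ?_
    filter_upwards [hw0] with x hx
    have hx' : 0 ≤ w x := hx
    rw [norm_mul, Real.norm_eq_abs, Real.norm_of_nonneg hx', Pi.add_apply, ← sq_abs]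
    nlinarith [mul_nonneg (sq_nonneg (|f x - c| - 1)) hx', abs_nonneg (f x - c),
      mul_nonneg (sq_nonneg (|f x - c|)) hx']
  have hfw : Integrable (fun x => f x * w x) ν := by
    refine (h1.add (hw.const_mul c)).congr (Filter.Eventually.of_forall fun x => ?_)
    simp only [Pi.add_apply]; ring
  have hzero : ∫ x, (f x - c) * w x ∂ν = 0 := by
    simp_rw [sub_mul]
    rw [integral_sub hfw (hw.const_mul c), integral_const_mul, hc, div_mul_cancel₀ _ hW, sub_self]
  have hsplit : (fun x => (f x - d) ^ 2 * w x) = fun x =>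
      ((f x - c) ^ 2 * w x + 2 * (c - d) * ((f x - c) * w x)) + (c - d) ^ 2 * w x := by
    funext x; ring
  have hi2 : Integrable (fun x =>
      (f x - c) ^ 2 * w x + 2 * (c - d) * ((f x - c) * w x)) ν :=
    hint.add (h1.const_mul (2 * (c - d)))
  have hid : Integrable (fun x => (f x - d) ^ 2 * w x) ν := by
    rw [hsplit]; exact hi2.add (hw.const_mul _)
  rw [← ofReal_integral_eq_lintegral_ofReal hid
    (hw0.mono fun x hx => mul_nonneg (sq_nonneg _) hx)]
  apply ENNReal.ofReal_le_ofReal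
  rw [hsplit, integral_add hi2 (hw.const_mul _), integral_add hint (h1.const_mul _),
    integral_const_mul, integral_const_mul, hzero]
  have : 0 ≤ ∫ x, w x ∂ν := integral_nonneg_of_ae hw0
  nlinarith [mul_nonneg (sq_nonneg (c - d)) this]

end Variance

/-- The weighted Poincaré inequality on a convex open set, for weights which do not decrease by
more than a constant factor over the first half of any segment. -/
lemma integral_sq_sub_average_mul_le_of_convex {V : Type*} [NormedAddCommGroup V]
    [NormedSpace ℝ V] [FiniteDimensional ℝ V] [MeasurableSpace V] [BorelSpace V]
    (μ : Measure V) [μ.IsAddHaarMeasure] {s : Set V} (hs : IsOpen s) (hconv : Convex ℝ s)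
    {f w : V → ℝ} (hf : ContDiffOn ℝ 1 f s) (hw : Continuous w) (hwpos : ∀ y ∈ s, 0 < w y)
    {K : ℝ} (hK0 : 0 ≤ K) (hK : ∀ y ∈ s, ∀ z ∈ s, ∀ t ∈ Set.Icc (0 : ℝ) (1 / 2),
      w y ≤ K * w (AffineMap.lineMap y z t))
    {D : ℝ} (hD : ∀ y ∈ s, ∀ z ∈ s, dist y z ≤ D)
    (hE : IntegrableOn (fun y => ‖fderiv ℝ f y‖ ^ 2 * w y) s μ) :
    ∫ y in s, (f y - (∫ z in s, f z * w z ∂μ) / ∫ z in s, w z ∂μ) ^ 2 * w y ∂μ ≤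
      D ^ 2 * (K * 2 ^ Module.finrank ℝ V) * ∫ y in s, ‖fderiv ℝ f y‖ ^ 2 * w y ∂μ := by
  have hae : ∀ᵐ y ∂μ.restrict s, y ∈ s := ae_restrict_mem hs.measurableSet
  have hE0 : 0 ≤ ∫ y in s, ‖fderiv ℝ f y‖ ^ 2 * w y ∂μ :=
    setIntegral_nonneg hs.measurableSet fun y hy => mul_nonneg (sq_nonneg _) (hwpos y hy).le
  have hR : 0 ≤ D ^ 2 * (K * 2 ^ Module.finrank ℝ V) *
      ∫ y in s, ‖fderiv ℝ f y‖ ^ 2 * w y ∂μ := by positivity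
  set c := (∫ z in s, f z * w z ∂μ) / ∫ z in s, w z ∂μ with hc
  by_cases hint : Integrable (fun y => (f y - c) ^ 2 * w y) (μ.restrict s)
  swap
  · rwa [integral_undef hint]
  rcases s.eq_empty_or_nonempty with rfl | hne
  · simp
  have hbdd : Bornology.IsBounded s := Metric.isBounded_iff.2 ⟨D, fun y hy z hz => hD y hy z hz⟩
  have hwint : IntegrableOn w s μ :=
    (hw.continuousOn.integrableOn_compact hbdd.isCompact_closure).mono_set subset_closure
  have hw0 : 0 ≤ᵐ[μ.restrict s] w := hae.mono fun y hy => (hwpos y hy).le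
  have hWpos : 0 < ∫ z in s, w z ∂μ := by
    rw [setIntegral_pos_iff_support_of_nonneg_ae hw0 hwint]
    refine (hs.measure_pos μ hne).trans_le (measure_mono fun y hy => ⟨(hwpos y hy).ne', hy⟩)
  have hfm : AEStronglyMeasurable f (μ.restrict s) :=
    hf.continuousOn.aestronglyMeasurable hs.measurableSet
  have hmain := lintegral_sq_sub_mul_le μ hs hconv hf (W := fun y => ENNReal.ofReal (w y))
    (K := ENNReal.ofReal K) hw.measurable.ennreal_ofReal
    (fun y hy z hz t ht => by
      rw [← ENNReal.ofReal_mul hK0]; exact ENNReal.ofReal_le_ofReal (hK y hy z hz t ht)) hD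
  have hWeq := ofReal_integral_eq_lintegral_ofReal hwint hw0
  have hEeq : ∫⁻ y in s, ENNReal.ofReal (‖fderiv ℝ f y‖ ^ 2) * ENNReal.ofReal (w y) ∂μ =
      ENNReal.ofReal (∫ y in s, ‖fderiv ℝ f y‖ ^ 2 * w y ∂μ) := by
    rw [ofReal_integral_eq_lintegral_ofReal hE
      (hw0.mono fun y hy => mul_nonneg (sq_nonneg _) hy)]
    simp_rw [ENNReal.ofReal_mul (sq_nonneg _)]
  have hlow : ENNReal.ofReal (∫ y in s, (f y - c) ^ 2 * w y ∂μ) *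
        ENNReal.ofReal (∫ z in s, w z ∂μ) ≤
      ∫⁻ z in s, ∫⁻ y in s, ENNReal.ofReal ((f y - f z) ^ 2) *
        (ENNReal.ofReal (w y) * ENNReal.ofReal (w z)) ∂μ ∂μ := by
    rw [hWeq, ← lintegral_const_mul _ hw.measurable.ennreal_ofReal]
    refine lintegral_mono fun z => ?_
    simp_rw [← mul_assoc]
    rw [lintegral_mul_const' _ _ ENNReal.ofReal_ne_top]
    simp_rw [← ENNReal.ofReal_mul (sq_nonneg _)]
    gcongr
    exact integral_sq_sub_average_mul_le hfm hwint hw0 hWpos.ne' hint (f z)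
  have hfin := hlow.trans hmain
  have h2 : (2 : ℝ≥0∞) ^ Module.finrank ℝ V = ENNReal.ofReal (2 ^ Module.finrank ℝ V) := by
    rw [ENNReal.ofReal_pow zero_le_two, ENNReal.ofReal_ofNat]
  rw [hEeq, ← hWeq, h2, ← ENNReal.ofReal_mul hK0, ← ENNReal.ofReal_mul' hWpos.le,
    ← ENNReal.ofReal_mul' hWpos.le, ← ENNReal.ofReal_mul' hE0, ← ENNReal.ofReal_mul (sq_nonneg D),
    ENNReal.ofReal_le_ofReal_iff (by positivity)] at hfin
  refine le_of_mul_le_mul_right (hfin.trans_eq ?_) hWpos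
  ring

section Box

variable {n : ℕ} {a : Fin n → ℝ}

lemma isOpen_box : IsOpen (box n a) := by
  have : box n a = ⋂ i, {x | |x i| < a i} := by ext; simp [box]
  rw [this]
  exact isOpen_iInter_of_finite fun i => isOpen_lt (by fun_prop) continuous_const

lemma convex_box : Convex ℝ (box n a) := by
  intro x hx y hy s t hs ht hst i
  have hx := abs_lt.1 (hx i)
  have hy := abs_lt.1 (hy i)
  have := convex_Ioo (-a i) (a i) (x := x i) ⟨hx.1, hx.2⟩ (y := y i) ⟨hy.1, hy.2⟩ hs ht hst
  simp only [smul_eq_mul, Set.mem_Ioo] at this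
  simpa [abs_lt] using this

lemma continuous_boxEigenfunction : Continuous (boxEigenfunction n a) := by
  unfold boxEigenfunction
  fun_prop

lemma abs_lt_pi_div_two {b u : ℝ} (hb : 0 < b) (hu : |u| < b) :
    π * u / (2 * b) ∈ Set.Ioo (-(π / 2)) (π / 2) := by
  have := abs_lt.1 hu
  constructor
  · rw [lt_div_iff₀ (by positivity)]; nlinarith [pi_pos]
  · rw [div_lt_iff₀ (by positivity)]; nlinarith [pi_pos]

lemma boxEigenfunction_pos (ha : ∀ i, 0 < a i) {x : EuclideanSpace ℝ (Fin n)}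
    (hx : x ∈ box n a) : 0 < boxEigenfunction n a x :=
  Finset.prod_pos fun i _ => mul_pos (by have := ha i; positivity)
    (cos_pos_of_mem_Ioo (abs_lt_pi_div_two (ha i) (hx i)))

lemma boxEigenfunction_le_two_pow_mul (ha : ∀ i, 0 < a i) {y z : EuclideanSpace ℝ (Fin n)}
    (hy : y ∈ box n a) (hz : z ∈ box n a) {t : ℝ} (ht : t ∈ Set.Icc (0 : ℝ) (1 / 2)) :
    boxEigenfunction n a y ≤ 2 ^ n * boxEigenfunction n a (AffineMap.lineMap y z t) := by
  have h2 : (2 : ℝ) ^ n = ∏ _i : Fin n, (2 : ℝ) := by simp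
  unfold boxEigenfunction
  rw [h2, ← Finset.prod_mul_distrib]
  have hcos (i) := abs_lt_pi_div_two (ha i) (hy i)
  refine Finset.prod_le_prod (fun i _ => mul_nonneg (by positivity)
    (cos_pos_of_mem_Ioo (hcos i)).le) fun i _ => ?_
  rw [mul_left_comm]
  gcongr
  have hzi := abs_lt_pi_div_two (ha i) (hz i)
  have h := strictConcaveOn_cos_Icc.concaveOn.2 (Set.Ioo_subset_Icc_self (hcos i))
    (Set.Ioo_subset_Icc_self hzi) (sub_nonneg.2 (ht.2.trans (by norm_num)) : 0 ≤ 1 - t) ht.1 (by ring)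
  have heq : π * (AffineMap.lineMap y z t : EuclideanSpace ℝ (Fin n)) i / (2 * a i) =
      (1 - t) • (π * y i / (2 * a i)) + t • (π * z i / (2 * a i)) := by
    simp only [AffineMap.lineMap_apply_module, PiLp.add_apply, PiLp.smul_apply, smul_eq_mul]
    ring
  rw [heq]
  simp only [smul_eq_mul] at h ⊢
  nlinarith [mul_nonneg ht.1 (cos_pos_of_mem_Ioo hzi).le,
    mul_nonneg (sub_nonneg.2 ht.2) (cos_pos_of_mem_Ioo (hcos i)).le]

end Box

theorem stmt_13 (n : ℕ) (hn : 1 ≤ n) :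
    ∃ P ≥ (1 : ℝ), ∃ C ≥ (1 : ℝ), ∀ a : Fin n → ℝ, (∀ i, 0 < a i) →
      ∀ x ∈ closure (box n a), ∀ r : ℝ, 0 < r →
        ∀ f : EuclideanSpace ℝ (Fin n) → ℝ, ContDiffOn ℝ (⊤ : ℕ∞) f (box n a) →
          IntegrableOn (fun y => ‖fderiv ℝ f y‖ ^ 2 * (boxEigenfunction n a y) ^ 2)
            (box n a ∩ Metric.ball x (C * r)) →
          (∫ y in box n a ∩ Metric.ball x r,
              (f y -
                  (∫ z in box n a ∩ Metric.ball x r, f z * (boxEigenfunction n a z) ^ 2) /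
                    (∫ z in box n a ∩ Metric.ball x r, (boxEigenfunction n a z) ^ 2)) ^ 2 *
                (boxEigenfunction n a y) ^ 2) ≤
            P * r ^ 2 *
              ∫ y in box n a ∩ Metric.ball x (C * r),
                ‖fderiv ℝ f y‖ ^ 2 * (boxEigenfunction n a y) ^ 2 := by
  refine ⟨4 * 8 ^ n, ?_, 1, le_rfl, ?_⟩
  · have : (1 : ℝ) ≤ 8 ^ n := one_le_pow₀ (by norm_num)
    linarith
  intro a ha x _ r _ f hf hE
  rw [one_mul] at hE ⊢
  have h := integral_sq_sub_average_mul_le_of_convex volume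
    (isOpen_box.inter Metric.isOpen_ball) (convex_box.inter (convex_ball x r))
    ((hf.mono Set.inter_subset_left).of_le (by exact_mod_cast le_top))
    (w := fun y => boxEigenfunction n a y ^ 2) (continuous_boxEigenfunction.pow 2)
    (fun y hy => pow_pos (boxEigenfunction_pos ha hy.1) 2) (K := 4 ^ n) (by positivity)
    (fun y hy z hz t ht => by
      have h4 : (4 : ℝ) ^ n = (2 ^ n) ^ 2 := by rw [← pow_mul, mul_comm, pow_mul]; norm_num
      rw [h4, ← mul_pow]
      exact pow_le_pow_left₀ (boxEigenfunction_pos ha hy.1).le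
        (boxEigenfunction_le_two_pow_mul ha hy.1 hz.1 ht) 2)
    (D := 2 * r) (fun y hy z hz => by
      have hy' := Metric.mem_ball.1 hy.2
      have hz' := Metric.mem_ball'.1 hz.2
      linarith [dist_triangle y x z]) hE
  refine h.trans_eq ?_
  rw [finrank_euclideanSpace_fin, ← mul_pow]
  ring
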